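/- (Table 1, row s = G₂(a₁), carrying the cuspidal unipotent character ³D₄[1]: the residue of the μ-function of G₂(3,1)[q] supporting the corresponding supercuspidal unipotent representation.) Let r be the point with α₁(r) = q and α₂(r) = 1. Then r is a residual point: exactly four roots α ∈ R₀ satisfy α(r) = q^{−m(α)} (namely −α₁, −(α₁+α₂) among the short roots and −(3α₁+α₂), −(3α₁+2α₂) among the long roots) while exactly the two roots ±α₂ satisfy α(r) = 1, so the defect is 4 − 2 = 2. Moreover there exist a sign ε₀ ∈ {1, −1} and an integer k such that Res(r) = ε₀ · q^{k} / (Φ₂² Φ₃² Φ₆²). -/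

import Mathlib

/-!
STATEMENT 17. Table 1, row `s = G₂(a₁)` (carrying the cuspidal unipotent character `³D₄[1]`):
the point `r` with `α₁(r) = q`, `α₂(r) = 1` is a residual point — exactly the four roots
`-α₁, -(α₁+α₂), -(3α₁+α₂), -(3α₁+2α₂)` satisfy `α(r) = q^{-m(α)}` and exactly `±α₂` satisfy
`α(r) = 1`, so the defect is `4 - 2 = 2` — and `Res(r) = ± q^k / (Φ₂²Φ₃²Φ₆²)`.
-/

open scoped Classical

noncomputable section

/-- The field `ℚ(q)` (so `q` is transcendental over `ℚ`). -/
abbrev Kq : Type := RatFunc ℚ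

/-- The indeterminate `q`. -/
def qG : Kq := RatFunc.X

/-- The `n`-th cyclotomic polynomial evaluated at `q`. -/
def Φ (n : ℕ) : Kq := Polynomial.aeval qG (Polynomial.cyclotomic n ℚ)

/-- The roots of the root system of type `G₂`, written in coordinates `(a, b)` for
`α = aα₁ + bα₂` with `α₁` short and `α₂` long. -/
def G2Roots : Finset (ℤ × ℤ) :=
  {(1, 0), (0, 1), (1, 1), (2, 1), (3, 1), (3, 2),
   (-1, 0), (0, -1), (-1, -1), (-2, -1), (-3, -1), (-3, -2)}

/-- The short roots of `G₂`. -/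
def G2Short : Finset (ℤ × ℤ) := {(1, 0), (1, 1), (2, 1), (-1, 0), (-1, -1), (-2, -1)}

/-- The parameters of `G₂(3,1)[q]`: `m(α) = 1` on short roots, `m(α) = 3` on long roots. -/
def mG2 (α : ℤ × ℤ) : ℤ := if α ∈ G2Short then 1 else 3

/-- Evaluation of the root `α = aα₁ + bα₂` at the point `r` with `α₁(r) = x`, `α₂(r) = y`. -/
def evG2 (x y : Kq) (α : ℤ × ℤ) : Kq := x ^ α.1 * y ^ α.2

/-- The normalized regularized residue of the μ-function of `G₂(3,1)[q]` at the point `r`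
with `α₁(r) = x`, `α₂(r) = y`; the normalization factor is `d = q²/((q-1)(q³-1))`. -/
def ResG2 (x y : Kq) : Kq :=
  (qG ^ 2 / ((qG - 1) * (qG ^ 3 - 1))) *
      (∏ α ∈ G2Roots.filter fun α => evG2 x y α ≠ 1, (1 - (evG2 x y α)⁻¹)) /
    ∏ α ∈ G2Roots.filter fun α => evG2 x y α ≠ qG ^ (-mG2 α),
      (1 - qG ^ (-mG2 α) * (evG2 x y α)⁻¹)

theorem qG_ne_zero : qG ≠ 0 := RatFunc.X_ne_zero

theorem qG_pow_ne_one {n : ℕ} (hn : n ≠ 0) : qG ^ n ≠ 1 := by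
  intro h
  have hX : (Polynomial.X : Polynomial ℚ) ^ n = 1 := by
    apply RatFunc.algebraMap_injective ℚ
    simpa [qG, RatFunc.algebraMap_X] using h
  have hdeg := congrArg Polynomial.natDegree hX
  simp [hn] at hdeg

theorem qG_zpow_eq_one_iff (n : ℤ) : qG ^ n = 1 ↔ n = 0 := by
  refine ⟨fun h => ?_, fun h => by simp [h]⟩
  by_contra hn
  have hpow : qG ^ n.natAbs = 1 := by
    rcases Int.natAbs_eq n with hn' | hn'
    · rwa [hn', zpow_natCast] at h
    · rwa [hn', zpow_neg, inv_eq_one, zpow_natCast] at h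
  exact qG_pow_ne_one (Int.natAbs_ne_zero.mpr hn) hpow

theorem qG_zpow_inj (a b : ℤ) : qG ^ a = qG ^ b ↔ a = b := by
  rw [← div_eq_one_iff_eq (zpow_ne_zero b qG_ne_zero), ← zpow_sub₀ qG_ne_zero,
    qG_zpow_eq_one_iff, sub_eq_zero]

theorem evG2_qG_one (α : ℤ × ℤ) : evG2 qG 1 α = qG ^ α.1 := by simp [evG2]

theorem filter_evG2_eq_zpow :
    G2Roots.filter (fun α => evG2 qG 1 α = qG ^ (-mG2 α)) =
      ({(-1, 0), (-1, -1), (-3, -1), (-3, -2)} : Finset (ℤ × ℤ)) := by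
  have h : G2Roots.filter (fun α => evG2 qG 1 α = qG ^ (-mG2 α)) =
      G2Roots.filter (fun α => α.1 = -mG2 α) := by
    ext α
    simp only [Finset.mem_filter, evG2_qG_one, qG_zpow_inj]
  rw [h]
  decide

theorem filter_evG2_ne_zpow :
    G2Roots.filter (fun α => evG2 qG 1 α ≠ qG ^ (-mG2 α)) =
      ({(1, 0), (0, 1), (1, 1), (2, 1), (3, 1), (3, 2), (0, -1), (-2, -1)} :
        Finset (ℤ × ℤ)) := by
  have h : G2Roots.filter (fun α => evG2 qG 1 α ≠ qG ^ (-mG2 α)) =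
      G2Roots.filter (fun α => α.1 ≠ -mG2 α) := by
    ext α
    simp only [Finset.mem_filter, evG2_qG_one, ne_eq, qG_zpow_inj]
  rw [h]
  decide

theorem filter_evG2_eq_one :
    G2Roots.filter (fun α => evG2 qG 1 α = 1) = ({(0, 1), (0, -1)} : Finset (ℤ × ℤ)) := by
  have h : G2Roots.filter (fun α => evG2 qG 1 α = 1) = G2Roots.filter (fun α => α.1 = 0) := by
    ext α
    simp only [Finset.mem_filter, evG2_qG_one, qG_zpow_eq_one_iff]
  rw [h]
  decide

theorem filter_evG2_ne_one :
    G2Roots.filter (fun α => evG2 qG 1 α ≠ 1) =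
      ({(1, 0), (1, 1), (2, 1), (3, 1), (3, 2), (-1, 0), (-1, -1), (-2, -1), (-3, -1),
        (-3, -2)} : Finset (ℤ × ℤ)) := by
  have h : G2Roots.filter (fun α => evG2 qG 1 α ≠ 1) = G2Roots.filter (fun α => α.1 ≠ 0) := by
    ext α
    simp only [Finset.mem_filter, evG2_qG_one, ne_eq, qG_zpow_eq_one_iff]
  rw [h]
  decide

theorem prod_ne_one :
    ∏ α ∈ G2Roots.filter fun α => evG2 qG 1 α ≠ 1, (1 - (evG2 qG 1 α)⁻¹) =
      -((qG - 1) ^ 4 * (qG ^ 2 - 1) ^ 2 * (qG ^ 3 - 1) ^ 4 / qG ^ 10) := by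
  have hq := qG_ne_zero
  rw [filter_evG2_ne_one]
  simp only [evG2_qG_one]
  repeat rw [Finset.prod_insert (by decide)]
  rw [Finset.prod_singleton]
  simp only [zpow_neg, inv_inv, zpow_ofNat]
  field_simp
  ring

theorem prod_ne_zpow :
    ∏ α ∈ G2Roots.filter fun α => evG2 qG 1 α ≠ qG ^ (-mG2 α),
        (1 - qG ^ (-mG2 α) * (evG2 qG 1 α)⁻¹) =
      -((qG - 1) * (qG ^ 2 - 1) ^ 2 * (qG ^ 3 - 1) ^ 3 * (qG ^ 6 - 1) ^ 2 / qG ^ 25) := by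
  have hq := qG_ne_zero
  rw [filter_evG2_ne_zpow]
  simp only [evG2_qG_one]
  repeat rw [Finset.prod_insert (by decide)]
  rw [Finset.prod_singleton]
  simp only [mG2, G2Short, Finset.mem_insert, Finset.mem_singleton, Prod.mk.injEq]
  norm_num
  field_simp
  ring

theorem Φ_two : Φ 2 = qG + 1 := by
  simp [Φ, Polynomial.cyclotomic_two]

theorem Φ_three : Φ 3 = qG ^ 2 + qG + 1 := by
  simp [Φ, Polynomial.cyclotomic_three]

theorem Φ_six : Φ 6 = qG ^ 2 - qG + 1 := by
  simp [Φ, Polynomial.cyclotomic_six]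

theorem qG_pow_six_sub_one : qG ^ 6 - 1 = (qG - 1) * (Φ 2 * Φ 3 * Φ 6) := by
  rw [Φ_two, Φ_three, Φ_six]
  ring

theorem resG2_qG_one : ResG2 qG 1 = qG ^ 17 / (Φ 2 ^ 2 * Φ 3 ^ 2 * Φ 6 ^ 2) := by
  have hq := qG_ne_zero
  have h1 : qG - 1 ≠ 0 := sub_ne_zero.mpr (by simpa using qG_pow_ne_one one_ne_zero)
  have h2 : qG ^ 2 - 1 ≠ 0 := sub_ne_zero.mpr (qG_pow_ne_one two_ne_zero)
  have h3 : qG ^ 3 - 1 ≠ 0 := sub_ne_zero.mpr (qG_pow_ne_one three_ne_zero)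
  have h6 : qG ^ 6 - 1 ≠ 0 := sub_ne_zero.mpr (qG_pow_ne_one (by norm_num))
  have hΦ : Φ 2 * Φ 3 * Φ 6 ≠ 0 := by
    rw [qG_pow_six_sub_one] at h6
    exact right_ne_zero_of_mul h6
  rw [ResG2, prod_ne_one, prod_ne_zpow, qG_pow_six_sub_one, ← mul_pow, ← mul_pow]
  generalize Φ 2 * Φ 3 * Φ 6 = c at hΦ
  generalize qG ^ 2 - 1 = u at h2
  generalize qG ^ 3 - 1 = v at h3
  generalize qG - 1 = w at h1
  field_simp

theorem statement17 :
    G2Roots.filter (fun α => evG2 qG 1 α = qG ^ (-mG2 α)) =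
        ({(-1, 0), (-1, -1), (-3, -1), (-3, -2)} : Finset (ℤ × ℤ)) ∧
      G2Roots.filter (fun α => evG2 qG 1 α = 1) = ({(0, 1), (0, -1)} : Finset (ℤ × ℤ)) ∧
      ((G2Roots.filter (fun α => evG2 qG 1 α = qG ^ (-mG2 α))).card : ℤ) -
          (G2Roots.filter (fun α => evG2 qG 1 α = 1)).card = 2 ∧
      ∃ ε₀ : Kq, (ε₀ = 1 ∨ ε₀ = -1) ∧ ∃ k : ℤ,
        ResG2 qG 1 = ε₀ * qG ^ k / (Φ 2 ^ 2 * Φ 3 ^ 2 * Φ 6 ^ 2) := by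
  refine ⟨filter_evG2_eq_zpow, filter_evG2_eq_one, ?_, 1, Or.inl rfl, 17, ?_⟩
  · rw [filter_evG2_eq_zpow, filter_evG2_eq_one]
    rfl
  · rw [resG2_qG_one, one_mul, zpow_ofNat]
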